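/- Suppose (θ₀,…,θ₆) ∈ (T³)⁷ is such that the set {θ₀¹, θ₁¹, …, θ₆¹} consists of at least 4 distinct points of S¹ but the seven points θ₀¹,…,θ₆¹ are not pairwise distinct. Then |Θ(θ₀,…,θ₆)| < 11/45. -/

import Mathlib

open scoped BigOperators
open scoped Classical

noncomputable section

instance : Fact ((0:ℝ) < 1) := ⟨one_pos⟩

/-- The circle `ℝ/ℤ` with its standard circular order. -/
abbrev S1 : Type := AddCircle (1 : ℝ)

/-- The 3-torus `S¹ × S¹ × S¹`. -/
abbrev T3 : Type := S1 × S1 × S1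

/-- The orientation cocycle on the circle: `1` if `(a,b,c)` are pairwise distinct and
positively oriented, `-1` if pairwise distinct and negatively oriented, `0` otherwise. -/
noncomputable def OrS1 (a b c : S1) : ℝ :=
  if sbtw a b c then 1 else if sbtw c b a then -1 else 0

/-- The cocycle `Θ` on `(T³)⁷`. -/
noncomputable def Theta (θ : Fin 7 → T3) : ℝ :=
  (1 / (Nat.factorial 7 : ℝ)) * ∑ σ : Equiv.Perm (Fin 7),
    ((Equiv.Perm.sign σ : ℤ) : ℝ) *
      (OrS1 (θ (σ 0)).1 (θ (σ 1)).1 (θ (σ 2)).1 *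
       OrS1 (θ (σ 2)).2.1 (θ (σ 3)).2.1 (θ (σ 4)).2.1 *
       OrS1 (θ (σ 4)).2.2 (θ (σ 5)).2.2 (θ (σ 6)).2.2)

/-! ### Alternating sums over permutations -/

/-- The alternating sum over all permutations of `{0, …, 6}` of the product of three functions
of triples that overlap as in the definition of `Theta`. -/
def altSum {R : Type} [CommRing R] (a b c : Fin 7 → Fin 7 → Fin 7 → R) : R :=
  ∑ σ : Equiv.Perm (Fin 7), ((Equiv.Perm.sign σ : ℤ) : R) *
    (a (σ 0) (σ 1) (σ 2) * b (σ 2) (σ 3) (σ 4) * c (σ 4) (σ 5) (σ 6))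

/-- The alternating sum of `F x r` over the entries `x` of a list, where `r` is the list with
that entry removed. -/
def altPick {α : Type} : List α → (α → List α → ℤ) → ℤ
  | [], _ => 0
  | x :: l, F => F x l - altPick l fun y r => F y (x :: r)

/-- The alternating sum of `G` over the arrangements of length `n` of a list. -/
def altArrange {α : Type} : ℕ → List α → (List α → ℤ) → ℤ
  | 0, _, G => G []
  | n + 1, l, G => altPick l fun x r => altArrange n r fun t => G (x :: t)

/-- Multiplication that does not evaluate its second argument when the first one vanishes. -/
def guardMul (x y : ℤ) : ℤ := if x = 0 then 0 else x * y

/-- An evaluation scheme for `altSum` over `ℤ`. -/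
def evalAltSum (a b c : Fin 7 → Fin 7 → Fin 7 → ℤ) : ℤ :=
  altPick [0, 1, 2, 3, 4, 5, 6] fun x₂ l => altPick l fun x₃ l => altPick l fun x₄ l =>
    guardMul (b x₂ x₃ x₄) <| altPick l fun x₀ l => altPick l fun x₁ l =>
      guardMul (a x₀ x₁ x₂) <| altPick l fun x₅ l => altPick l fun x₆ _ => c x₄ x₅ x₆

/-- The permutation with value `i` at `0` and `i.succAbove ∘ τ` on successors. -/
def consPerm {n : ℕ} (i : Fin (n + 1)) (τ : Equiv.Perm (Fin n)) : Equiv.Perm (Fin (n + 1)) :=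
  i.cycleRange⁻¹ * Equiv.Perm.decomposeFin.symm (0, τ)

theorem consPerm_zero {n : ℕ} (i : Fin (n + 1)) (τ : Equiv.Perm (Fin n)) :
    consPerm i τ 0 = i := by
  simp [consPerm, Fin.cycleRange_symm_zero]

theorem consPerm_succ {n : ℕ} (i : Fin (n + 1)) (τ : Equiv.Perm (Fin n)) (j : Fin n) :
    consPerm i τ j.succ = i.succAbove (τ j) := by
  simp [consPerm]

theorem sign_consPerm {n : ℕ} (i : Fin (n + 1)) (τ : Equiv.Perm (Fin n)) :
    ((Equiv.Perm.sign (consPerm i τ) : ℤˣ) : ℤ) = (-1) ^ (i : ℕ) * (Equiv.Perm.sign τ : ℤ) := by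
  simp [consPerm, Fin.sign_cycleRange, Equiv.Perm.decomposeFin.symm_sign]

theorem consPerm_bijective (n : ℕ) :
    Function.Bijective fun p : Fin (n + 1) × Equiv.Perm (Fin n) => consPerm p.1 p.2 := by
  rw [Fintype.bijective_iff_injective_and_card]
  constructor
  · rintro ⟨i, τ⟩ ⟨j, υ⟩ h
    have h0 : i = j := by
      have := congrArg (fun σ : Equiv.Perm (Fin (n + 1)) => σ 0) h
      simpa only [consPerm_zero] using this
    subst h0
    congr 1
    ext k : 1
    have := congrArg (fun σ : Equiv.Perm (Fin (n + 1)) => σ k.succ) h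
    simp only [consPerm_succ] at this
    exact Fin.succAbove_right_injective this
  · simp [Fintype.card_perm, Nat.factorial_succ]

theorem altPick_ofFn {α : Type} : ∀ {n : ℕ} (e : Fin (n + 1) → α) (F : α → List α → ℤ),
    altPick (List.ofFn e) F =
      ∑ i : Fin (n + 1), (-1) ^ (i : ℕ) * F (e i) (List.ofFn fun j => e (i.succAbove j)) := by
  intro n
  induction n with
  | zero =>
    intro e F
    simp [altPick]
  | succ n ih =>
    intro e F
    rw [List.ofFn_succ, altPick, ih, Fin.sum_univ_succ (n := n + 1), sub_eq_add_neg,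
      ← Finset.sum_neg_distrib]
    congr 1
    · simp
    · refine Finset.sum_congr rfl fun i _ => ?_
      rw [List.ofFn_succ (f := fun j => e (i.succ.succAbove j))]
      simp [pow_succ]

theorem sum_perm_eq_altArrange {α : Type} : ∀ {n : ℕ} (e : Fin n → α) (G : List α → ℤ),
    ∑ σ : Equiv.Perm (Fin n), (Equiv.Perm.sign σ : ℤ) * G (List.ofFn fun j => e (σ j)) =
      altArrange n (List.ofFn e) G := by
  intro n
  induction n with
  | zero =>
    intro e G
    simp [altArrange]
  | succ n ih =>
    intro e G
    rw [altArrange, altPick_ofFn, ← (consPerm_bijective n).sum_comp, Fintype.sum_prod_type]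
    refine Finset.sum_congr rfl fun i _ => ?_
    rw [← ih, Finset.mul_sum]
    refine Finset.sum_congr rfl fun τ _ => ?_
    rw [List.ofFn_succ, consPerm_zero, sign_consPerm, mul_assoc]
    simp only [consPerm_succ]

theorem mul_altPick {α : Type} (k : ℤ) (l : List α) (F : α → List α → ℤ) :
    k * altPick l F = altPick l fun x r => k * F x r := by
  induction l generalizing F with
  | nil => simp [altPick]
  | cons x l ih => simp [altPick, mul_sub, ih]

theorem guardMul_eq (x y : ℤ) : guardMul x y = x * y := by
  unfold guardMul
  split_ifs with h <;> simp [h]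

/-- The order in which `evalAltSum` runs through the seven positions of `altSum`. -/
def evalOrder : Equiv.Perm (Fin 7) where
  toFun := ![2, 3, 4, 0, 1, 5, 6]
  invFun := ![3, 4, 0, 1, 2, 5, 6]
  left_inv := by decide
  right_inv := by decide

theorem altSum_eq_evalAltSum (a b c : Fin 7 → Fin 7 → Fin 7 → ℤ) :
    altSum a b c = evalAltSum a b c := by
  have hs : Equiv.Perm.sign evalOrder = 1 := by decide
  have h := sum_perm_eq_altArrange (n := 7) (id : Fin 7 → Fin 7) fun l =>
    b (l.getD 0 0) (l.getD 1 0) (l.getD 2 0) * (a (l.getD 3 0) (l.getD 4 0) (l.getD 0 0) *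
      c (l.getD 2 0) (l.getD 5 0) (l.getD 6 0))
  refine Eq.trans (Eq.trans ?_ h) ?_
  · rw [altSum, ← Equiv.sum_comp (Equiv.mulRight evalOrder⁻¹)]
    refine Finset.sum_congr rfl fun σ _ => ?_
    have h0 : evalOrder⁻¹ 0 = 3 := rfl
    have h1 : evalOrder⁻¹ 1 = 4 := rfl
    have h2 : evalOrder⁻¹ 2 = 0 := rfl
    have h3 : evalOrder⁻¹ 3 = 1 := rfl
    have h4 : evalOrder⁻¹ 4 = 2 := rfl
    have h5 : evalOrder⁻¹ 5 = 5 := rfl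
    have h6 : evalOrder⁻¹ 6 = 6 := rfl
    simp only [Equiv.coe_mulRight, Equiv.Perm.mul_apply, Equiv.Perm.sign_mul,
      Equiv.Perm.sign_inv, hs, mul_one, h0, h1, h2, h3, h4, h5, h6]
    simp [List.ofFn_succ, mul_left_comm, mul_assoc]
  · simp only [evalAltSum, guardMul_eq, mul_altPick]
    rfl

theorem altSum_comp_perm {R : Type} [CommRing R] (π : Equiv.Perm (Fin 7))
    (a b c : Fin 7 → Fin 7 → Fin 7 → R) :
    altSum (fun i j k => a (π i) (π j) (π k)) (fun i j k => b (π i) (π j) (π k))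
      (fun i j k => c (π i) (π j) (π k)) = ((Equiv.Perm.sign π : ℤ) : R) * altSum a b c := by
  unfold altSum
  refine Eq.trans ?_ (congrArg _ (Equiv.sum_comp (Equiv.mulLeft π) _))
  rw [Finset.mul_sum]
  refine Finset.sum_congr rfl fun σ _ => ?_
  have h : ((Equiv.Perm.sign π : ℤ) : R) * ((Equiv.Perm.sign π : ℤ) : R) = 1 := by
    rw [← Int.cast_mul, ← Units.val_mul, Int.units_mul_self]
    simp
  simp only [Equiv.coe_mulLeft, Equiv.Perm.mul_apply, Equiv.Perm.sign_mul, Units.val_mul,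
    Int.cast_mul]
  linear_combination (-(((Equiv.Perm.sign σ : ℤ) : R) * (a (π (σ 0)) (π (σ 1)) (π (σ 2)) *
    b (π (σ 2)) (π (σ 3)) (π (σ 4)) * c (π (σ 4)) (π (σ 5)) (π (σ 6))))) * h

theorem abs_altSum_comp_perm (π : Equiv.Perm (Fin 7)) (a b c : Fin 7 → Fin 7 → Fin 7 → ℝ) :
    |altSum (fun i j k => a (π i) (π j) (π k)) (fun i j k => b (π i) (π j) (π k))
      (fun i j k => c (π i) (π j) (π k))| = |altSum a b c| := by
  rw [altSum_comp_perm, abs_mul]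
  rcases Int.units_eq_one_or (Equiv.Perm.sign π) with h | h <;> simp [h]

theorem altSum_add_left {R : Type} [CommRing R] (a a' b c : Fin 7 → Fin 7 → Fin 7 → R) :
    altSum (fun i j k => a i j k + a' i j k) b c = altSum a b c + altSum a' b c := by
  simp only [altSum, add_mul, mul_add, Finset.sum_add_distrib]

theorem altSum_mul_left {R : Type} [CommRing R] (t : R) (a b c : Fin 7 → Fin 7 → Fin 7 → R) :
    altSum (fun i j k => t * a i j k) b c = t * altSum a b c := by
  simp only [altSum, Finset.mul_sum]
  exact Finset.sum_congr rfl fun σ _ => by ring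

theorem altSum_sum_mid {R ι : Type} [CommRing R] [Fintype ι] (t : ι → R)
    (a : Fin 7 → Fin 7 → Fin 7 → R) (b : ι → Fin 7 → Fin 7 → Fin 7 → R)
    (c : Fin 7 → Fin 7 → Fin 7 → R) :
    altSum a (fun i j k => ∑ p, t p * b p i j k) c = ∑ p, t p * altSum a (b p) c := by
  simp only [altSum, Finset.mul_sum, Finset.sum_mul]
  rw [Finset.sum_comm]
  exact Finset.sum_congr rfl fun p _ => Finset.sum_congr rfl fun σ _ => by ring

theorem altSum_sum_right {R ι : Type} [CommRing R] [Fintype ι] (t : ι → R)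
    (a b : Fin 7 → Fin 7 → Fin 7 → R) (c : ι → Fin 7 → Fin 7 → Fin 7 → R) :
    altSum a b (fun i j k => ∑ p, t p * c p i j k) = ∑ p, t p * altSum a b (c p) := by
  simp only [altSum, Finset.mul_sum]
  rw [Finset.sum_comm]
  exact Finset.sum_congr rfl fun p _ => Finset.sum_congr rfl fun σ _ => by ring

theorem altSum_intCast (a b c : Fin 7 → Fin 7 → Fin 7 → ℤ) :
    altSum (fun i j k => (a i j k : ℝ)) (fun i j k => (b i j k : ℝ)) (fun i j k => (c i j k : ℝ)) =
      ((altSum a b c : ℤ) : ℝ) := by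
  simp [altSum]

/-! ### The bilinear form attached to a standard degenerate configuration -/

/-- The coboundary of `g`. -/
def cyc {R : Type} [Add R] {n : ℕ} (g : Fin n → Fin n → R) (x y z : Fin n) : R :=
  g x y + g y z + g z x

/-- The antisymmetric matrix unit. -/
def antiUnit (i j x y : Fin 7) : ℤ :=
  if x = i ∧ y = j then 1 else if x = j ∧ y = i then -1 else 0

/-- The order signs of the configuration in which `0` and `1` coincide and the remaining points
follow in their natural order. -/
def tiedSign (x y : Fin 7) : ℤ :=
  if x ≤ 1 ∨ y ≤ 1 then 0 else if x < y then 1 else if y < x then -1 else 0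

/-- The smaller entry of the `p`-th pair in `{1, …, 6}`. -/
def pairFst : Fin 15 → Fin 7 := ![1, 1, 1, 1, 1, 2, 2, 2, 2, 3, 3, 3, 4, 4, 5]

/-- The larger entry of the `p`-th pair in `{1, …, 6}`. -/
def pairSnd : Fin 15 → Fin 7 := ![2, 3, 4, 5, 6, 3, 4, 5, 6, 4, 5, 6, 5, 6, 6]

/-- The alternating sum of `Y` over the pairs of indices other than `j`. -/
def wgt {R : Type} [Ring R] (Y : Fin 5 → Fin 5 → R) (j : Fin 5) : R :=
  Y (j.succAbove 0) (j.succAbove 1) - Y (j.succAbove 0) (j.succAbove 2)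
    + Y (j.succAbove 0) (j.succAbove 3) + Y (j.succAbove 1) (j.succAbove 2)
    - Y (j.succAbove 1) (j.succAbove 3) + Y (j.succAbove 2) (j.succAbove 3)

/-- The alternating pairing of `X` with the weights of `Y`. -/
def pairing {R : Type} [Ring R] (X : Fin 5 → R) (Y : Fin 5 → Fin 5 → R) : R :=
  X 0 * wgt Y 0 - X 1 * wgt Y 1 + X 2 * wgt Y 2 - X 3 * wgt Y 3 + X 4 * wgt Y 4

/-- The symmetric bilinear form computing `altSum` on the standard degenerate configuration. -/
def pairForm {R : Type} [Ring R] (g h : Fin 6 → Fin 6 → R) : R :=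
  pairing (fun j => g 0 j.succ) (fun i j => h i.succ j.succ) +
    pairing (fun j => h 0 j.succ) (fun i j => g i.succ j.succ)

theorem pairForm_comm {R : Type} [Ring R] (g h : Fin 6 → Fin 6 → R) :
    pairForm g h = pairForm h g := add_comm _ _

theorem wgt_sum {ι : Type} [Fintype ι] (t : ι → ℝ) (Y : ι → Fin 5 → Fin 5 → ℝ) (j : Fin 5) :
    wgt (fun x y => ∑ p, t p * Y p x y) j = ∑ p, t p * wgt (Y p) j := by
  simp only [wgt, mul_add, mul_sub, Finset.sum_add_distrib, Finset.sum_sub_distrib]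

theorem pairForm_sum_left {ι : Type} [Fintype ι] (t : ι → ℝ) (g : ι → Fin 6 → Fin 6 → ℝ)
    (h : Fin 6 → Fin 6 → ℝ) :
    pairForm (fun x y => ∑ p, t p * g p x y) h = ∑ p, t p * pairForm (g p) h := by
  simp only [pairForm, pairing, mul_add, mul_sub, Finset.sum_add_distrib, Finset.sum_sub_distrib,
    wgt_sum, Finset.sum_mul, Finset.mul_sum, mul_assoc, mul_left_comm (h _ _)]

theorem pairForm_sum_right {ι : Type} [Fintype ι] (t : ι → ℝ) (g : Fin 6 → Fin 6 → ℝ)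
    (h : ι → Fin 6 → Fin 6 → ℝ) :
    pairForm g (fun x y => ∑ p, t p * h p x y) = ∑ p, t p * pairForm g (h p) := by
  rw [pairForm_comm, pairForm_sum_left]
  exact Finset.sum_congr rfl fun p _ => by rw [pairForm_comm]

theorem pairForm_intCast (g h : Fin 6 → Fin 6 → ℤ) :
    pairForm (fun x y => (g x y : ℝ)) (fun x y => (h x y : ℝ)) = ((pairForm g h : ℤ) : ℝ) := by
  simp [pairForm, pairing, wgt]

set_option maxRecDepth 10000 in
theorem evalAltSum_antiUnit : ∀ p q : Fin 15,
    evalAltSum (cyc tiedSign) (cyc (antiUnit (pairFst p) (pairSnd p)))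
      (cyc (antiUnit (pairFst q) (pairSnd q))) =
    56 * pairForm (fun x y => antiUnit (pairFst p) (pairSnd p) x.succ y.succ)
      (fun x y => antiUnit (pairFst q) (pairSnd q) x.succ y.succ) := by
  decide +kernel

theorem sum_antiUnit (g : Fin 7 → Fin 7 → ℝ) (hg : ∀ x y, g x y = -g y x) (h0 : ∀ y, g 0 y = 0)
    (x y : Fin 7) :
    g x y = ∑ p, g (pairFst p) (pairSnd p) * (antiUnit (pairFst p) (pairSnd p) x y : ℝ) := by
  have hd : ∀ x, g x x = 0 := fun x => by linarith [hg x x]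
  have h0' : ∀ x, g x 0 = 0 := fun x => by rw [hg, h0, neg_zero]
  fin_cases x <;> fin_cases y <;>
    simp [Fin.sum_univ_succ, pairFst, pairSnd, antiUnit, h0, h0', hd] <;> exact hg _ _

theorem altSum_tiedSign (g h : Fin 7 → Fin 7 → ℝ) (hg : ∀ x y, g x y = -g y x)
    (hg0 : ∀ y, g 0 y = 0) (hh : ∀ x y, h x y = -h y x) (hh0 : ∀ y, h 0 y = 0) :
    altSum (fun i j k => ((cyc tiedSign i j k : ℤ) : ℝ)) (cyc g) (cyc h) =
      56 * pairForm (fun x y => g x.succ y.succ) (fun x y => h x.succ y.succ) := by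
  have key : ∀ f : Fin 7 → Fin 7 → ℝ, (∀ x y, f x y = -f y x) → (∀ y, f 0 y = 0) →
      cyc f = fun i j k => ∑ p, f (pairFst p) (pairSnd p) *
        ((cyc (antiUnit (pairFst p) (pairSnd p)) i j k : ℤ) : ℝ) := by
    intro f hf hf0
    funext i j k
    simp only [cyc, Int.cast_add, mul_add, Finset.sum_add_distrib]
    rw [← sum_antiUnit f hf hf0, ← sum_antiUnit f hf hf0, ← sum_antiUnit f hf hf0]
  have key' : ∀ f : Fin 7 → Fin 7 → ℝ, (∀ x y, f x y = -f y x) → (∀ y, f 0 y = 0) →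
      (fun x y : Fin 6 => f x.succ y.succ) = fun x y => ∑ p, f (pairFst p) (pairSnd p) *
        (antiUnit (pairFst p) (pairSnd p) x.succ y.succ : ℝ) := by
    intro f hf hf0
    funext x y
    exact sum_antiUnit f hf hf0 _ _
  rw [key g hg hg0, key h hh hh0, key' g hg hg0, key' h hh hh0, altSum_sum_mid,
    pairForm_sum_left, Finset.mul_sum]
  refine Finset.sum_congr rfl fun p _ => ?_
  rw [altSum_sum_right, pairForm_sum_right, Finset.mul_sum, Finset.mul_sum, Finset.mul_sum]
  refine Finset.sum_congr rfl fun q _ => ?_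
  rw [altSum_intCast, altSum_eq_evalAltSum, evalAltSum_antiUnit,
    pairForm_intCast (fun x y => antiUnit _ _ x.succ y.succ)]
  push_cast
  ring

/-! ### Bounding the form on strict orders -/

/-- The order sign of the values of `ρ`. -/
def posSign {n : ℕ} (ρ : Fin n → Fin n) (i j : Fin n) : ℤ :=
  if ρ i < ρ j then 1 else if ρ j < ρ i then -1 else 0

/-- The order sign of a point inserted at position `t`. -/
def insertSign (t : Fin 6) (ρ : Fin 5 → Fin 5) (i : Fin 5) : ℤ :=
  if t.val ≤ (ρ i).val then 1 else -1

/-- The sum of the absolute values of the weights of an order. -/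
def wgtSum (ρ : Fin 5 → Fin 5) : ℕ :=
  (wgt (posSign ρ) 0).natAbs + (wgt (posSign ρ) 1).natAbs + (wgt (posSign ρ) 2).natAbs +
    (wgt (posSign ρ) 3).natAbs + (wgt (posSign ρ) 4).natAbs

/-- The entries of a list, each together with the list of the remaining entries. -/
def picks {α : Type} : List α → List (α × List α)
  | [] => []
  | x :: l => (x, l) :: (picks l).map fun p => (p.1, x :: p.2)

/-- The arrangements of length `n` of a list. -/
def arrangements {α : Type} : ℕ → List α → List (List α)
  | 0, _ => [[]]
  | n + 1, l => (picks l).flatMap fun p => (arrangements n p.2).map (p.1 :: ·)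

/-- A list of entries read as a function. -/
def listFun (l : List (Fin 5)) (i : Fin 5) : Fin 5 := l.getD i 0

theorem listFun_ofFn (ρ : Fin 5 → Fin 5) : listFun (List.ofFn ρ) = ρ := by
  funext i
  simp only [listFun, List.getD_eq_getElem?_getD, List.getElem?_ofFn, Fin.is_lt, dite_true,
    Fin.eta, Option.getD_some]

set_option maxRecDepth 10000 in
theorem ofFn_perm_mem_arrangements :
    ∀ ρ : Equiv.Perm (Fin 5), List.ofFn ρ ∈ arrangements 5 [0, 1, 2, 3, 4] := by
  decide +kernel

set_option maxRecDepth 10000 in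
theorem arrangements_bound :
    ∀ a ∈ arrangements 5 [0, 1, 2, 3, 4], ∀ b ∈ arrangements 5 [0, 1, 2, 3, 4],
      wgtSum (listFun a) + wgtSum (listFun b) ≤ 21 ∨
      ∀ s t : Fin 6, |pairing (insertSign s (listFun a)) (posSign (listFun b)) +
        pairing (insertSign t (listFun b)) (posSign (listFun a))| ≤ 21 := by
  decide +kernel

theorem abs_pairing_le (X : Fin 5 → ℤ) (hX : ∀ i, |X i| = 1) (ρ : Fin 5 → Fin 5) :
    |pairing X (posSign ρ)| ≤ wgtSum ρ := by
  have h : ∀ i, |X i * wgt (posSign ρ) i| = |wgt (posSign ρ) i| := fun i => by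
    rw [abs_mul, hX, one_mul]
  simp only [wgtSum, pairing, Nat.cast_add, Int.natCast_natAbs, ← h]
  grind

theorem abs_insertSign (t : Fin 6) (ρ : Fin 5 → Fin 5) (i : Fin 5) : |insertSign t ρ i| = 1 := by
  unfold insertSign
  split_ifs <;> simp

theorem abs_pairing_add_pairing_le (ρ υ : Equiv.Perm (Fin 5)) (s t : Fin 6) :
    |pairing (insertSign s ρ) (posSign υ) + pairing (insertSign t υ) (posSign ρ)| ≤ 21 := by
  have h := arrangements_bound _ (ofFn_perm_mem_arrangements ρ) _ (ofFn_perm_mem_arrangements υ)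
  simp only [listFun_ofFn] at h
  rcases h with h | h
  · have h1 := abs_pairing_le _ (abs_insertSign s ρ) υ
    have h2 := abs_pairing_le _ (abs_insertSign t υ) ρ
    have h3 := abs_add_le (pairing (insertSign s ρ) (posSign υ))
      (pairing (insertSign t υ) (posSign ρ))
    omega
  · exact h s t

theorem abs_pairForm_posSign_le (σ τ : Equiv.Perm (Fin 6)) :
    |pairForm (posSign σ) (posSign τ)| ≤ 21 := by
  have key : ∀ σ : Equiv.Perm (Fin 6), ∃ (s : Fin 6) (ρ : Equiv.Perm (Fin 5)),
      (fun j : Fin 5 => posSign σ 0 j.succ) = insertSign s ρ ∧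
      (fun i j : Fin 5 => posSign σ i.succ j.succ) = posSign ρ := by
    intro σ
    obtain ⟨⟨s, ρ⟩, rfl⟩ := (consPerm_bijective 5).2 σ
    refine ⟨s, ρ, ?_, ?_⟩
    · funext j
      have h1 : s < s.succAbove (ρ j) ↔ s.val ≤ (ρ j).val := by
        rw [Fin.lt_succAbove_iff_le_castSucc, Fin.le_def, Fin.val_castSucc]
      have h2 : s.succAbove (ρ j) ≠ s := Fin.succAbove_ne _ _
      simp only [posSign, insertSign, consPerm_zero, consPerm_succ, ← h1]
      split_ifs with h h'
      · rfl
      · rfl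
      · exact absurd (le_antisymm (not_lt.1 h) (not_lt.1 h')) h2
    · funext i j
      simp only [posSign, consPerm_succ, Fin.succAbove_lt_succAbove_iff]
  obtain ⟨s, ρ, h1, h2⟩ := key σ
  obtain ⟨t, υ, h3, h4⟩ := key τ
  rw [pairForm, h1, h2, h3, h4]
  exact abs_pairing_add_pairing_le ρ υ s t

/-! ### Weak orders as averages of strict orders -/

/-- The order sign of the keys `a` and `b`, degenerate when one of them is the base key `0`. -/
def keySign (a b : ℝ) : ℝ :=
  if a = 0 ∨ b = 0 then 0 else if a < b then 1 else if b < a then -1 else 0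

theorem keySign_antisymm (a b : ℝ) : keySign a b = -keySign b a := by
  unfold keySign
  grind

theorem keySign_zero_left (b : ℝ) : keySign 0 b = 0 := by
  simp [keySign]

theorem keySign_zero_right (a : ℝ) : keySign a 0 = 0 := by
  simp [keySign]

theorem exists_perm_lt_iff {n : ℕ} {L : Type} [LinearOrder L] (k : Fin n → L)
    (hk : Function.Injective k) :
    ∃ τ : Equiv.Perm (Fin n), ∀ i j, τ i < τ j ↔ k i < k j := by
  refine ⟨(Tuple.sort k)⁻¹, fun i j => ?_⟩
  have hm : StrictMono (k ∘ Tuple.sort k) :=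
    (Tuple.monotone_sort k).strictMono_of_injective (hk.comp (Tuple.sort k).injective)
  rw [← hm.lt_iff_lt]
  simp

theorem exists_keySign_eq_average {n : ℕ} (r : Fin n → ℝ) (h0 : ∀ i, 0 ≤ r i)
    (h1 : ∀ i, r i < 1) :
    ∃ σ τ : Equiv.Perm (Fin n), ∀ i j,
      keySign (r i) (r j) = ((posSign σ i j : ℝ) + (posSign τ i j : ℝ)) / 2 := by
  obtain ⟨σ, hσ⟩ := exists_perm_lt_iff (fun i => toLex (r i, i)) (fun i j h => by
    simpa using (congrArg (fun p => (ofLex p).2) h))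
  obtain ⟨τ, hτ⟩ := exists_perm_lt_iff
    (fun i => toLex (if r i = 0 then (1 : ℝ) else r i, i.rev)) (fun i j h => by
    simpa using (congrArg (fun p => (ofLex p).2) h))
  refine ⟨σ, τ, fun i j => ?_⟩
  simp only [posSign, hσ, hτ, Prod.Lex.toLex_lt_toLex, keySign, Fin.rev_lt_rev]
  have hi0 := h0 i
  have hj0 := h0 j
  have hi1 := h1 i
  have hj1 := h1 j
  rcases lt_trichotomy i j with hij | rfl | hij
  · have hij' := hij.not_gt
    simp only [hij, hij', and_true, and_false, or_false, Int.cast_ite, Int.cast_one,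
      Int.cast_neg, Int.cast_zero]
    rcases hi0.eq_or_lt with hi | hi <;> rcases hj0.eq_or_lt with hj | hj <;>
      rcases lt_trichotomy (r i) (r j) with h | h | h <;>
      grind
  · simp
  · have hij' := hij.not_gt
    simp only [hij, hij', and_true, and_false, or_false, Int.cast_ite, Int.cast_one,
      Int.cast_neg, Int.cast_zero]
    rcases hi0.eq_or_lt with hi | hi <;> rcases hj0.eq_or_lt with hj | hj <;>
      rcases lt_trichotomy (r i) (r j) with h | h | h <;>
      grind

theorem abs_pairForm_keySign_le (r s : Fin 6 → ℝ) (hr0 : ∀ i, 0 ≤ r i) (hr1 : ∀ i, r i < 1)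
    (hs0 : ∀ i, 0 ≤ s i) (hs1 : ∀ i, s i < 1) :
    |pairForm (fun i j => keySign (r i) (r j)) (fun i j => keySign (s i) (s j))| ≤ 21 := by
  obtain ⟨σ, σ', hσ⟩ := exists_keySign_eq_average r hr0 hr1
  obtain ⟨τ, τ', hτ⟩ := exists_keySign_eq_average s hs0 hs1
  have hb : ∀ σ τ : Equiv.Perm (Fin 6),
      |pairForm (fun i j => (posSign σ i j : ℝ)) (fun i j => (posSign τ i j : ℝ))| ≤ 21 := by
    intro σ τ
    rw [pairForm_intCast (posSign σ) (posSign τ)]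
    exact_mod_cast abs_pairForm_posSign_le σ τ
  have hg : (fun i j => keySign (r i) (r j)) = fun i j =>
      ∑ p : Fin 2, (1 / 2 : ℝ) * (posSign (![σ, σ'] p) i j : ℝ) := by
    funext i j
    simp [Fin.sum_univ_succ, hσ]
    ring
  have hh : (fun i j => keySign (s i) (s j)) = fun i j =>
      ∑ p : Fin 2, (1 / 2 : ℝ) * (posSign (![τ, τ'] p) i j : ℝ) := by
    funext i j
    simp [Fin.sum_univ_succ, hτ]
    ring
  rw [hg, hh, pairForm_sum_left (fun _ => 1 / 2) fun p i j => (posSign (![σ, σ'] p) i j : ℝ)]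
  simp only [pairForm_sum_right (fun _ => 1 / 2) _ fun p i j => (posSign (![τ, τ'] p) i j : ℝ)]
  simp only [Fin.sum_univ_two, Matrix.cons_val_zero, Matrix.cons_val_one]
  have h1 := abs_le.1 (hb σ τ)
  have h2 := abs_le.1 (hb σ τ')
  have h3 := abs_le.1 (hb σ' τ)
  have h4 := abs_le.1 (hb σ' τ')
  rw [abs_le]
  constructor <;> linarith

/-! ### Circular orientation in terms of keys -/

theorem btw_coe_iff_of_mem {p α β γ : ℝ} (hα : α ∈ Set.Ico p (p + 1))
    (hβ : β ∈ Set.Ico p (p + 1)) (hγ : γ ∈ Set.Ico p (p + 1)) :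
    btw (α : S1) (β : S1) (γ : S1) ↔
      (if α ≤ β then β else β + 1) ≤ (if α < γ then γ else γ + 1) := by
  obtain ⟨hα0, hα1⟩ := hα
  obtain ⟨hβ0, hβ1⟩ := hβ
  obtain ⟨hγ0, hγ1⟩ := hγ
  have h1 : toIcoMod one_pos α β = if α ≤ β then β else β + 1 := by
    rw [toIcoMod_eq_iff]
    split_ifs with h
    · exact ⟨⟨h, by linarith⟩, 0, by simp⟩
    · exact ⟨⟨by linarith, by linarith⟩, -1, by simp⟩
  have h2 : toIocMod one_pos α γ = if α < γ then γ else γ + 1 := by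
    rw [toIocMod_eq_iff]
    split_ifs with h
    · exact ⟨⟨h, by linarith⟩, 0, by simp⟩
    · exact ⟨⟨by linarith, by linarith⟩, -1, by simp⟩
  rw [← h1, ← h2]
  exact QuotientAddGroup.btw_coe_iff

theorem exists_key (p : S1) :
    ∃ r : S1 → ℝ, (∀ x, 0 ≤ r x) ∧ (∀ x, r x < 1) ∧ r p = 0 ∧ ∀ x y z,
      OrS1 x y z = keySign (r x) (r y) + keySign (r y) (r z) + keySign (r z) (r x) := by
  obtain ⟨q, rfl⟩ := QuotientAddGroup.mk_surjective p
  refine ⟨fun x => (AddCircle.equivIco 1 q x : ℝ) - q, fun x => ?_, fun x => ?_, ?_, ?_⟩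
  · linarith [(AddCircle.equivIco 1 q x).2.1]
  · linarith [(AddCircle.equivIco 1 q x).2.2]
  · have : AddCircle.equivIco 1 q (q : S1) = ⟨q, by simp⟩ := by
      rw [← Equiv.eq_symm_apply]
      rfl
    change ((AddCircle.equivIco 1 q (q : S1) : ℝ)) - q = 0
    rw [this]
    simp
  · intro x y z
    obtain ⟨⟨α, hα⟩, rfl⟩ := (AddCircle.equivIco 1 q).symm.surjective x
    obtain ⟨⟨β, hβ⟩, rfl⟩ := (AddCircle.equivIco 1 q).symm.surjective y
    obtain ⟨⟨γ, hγ⟩, rfl⟩ := (AddCircle.equivIco 1 q).symm.surjective z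
    simp only [Equiv.apply_symm_apply]
    change OrS1 (α : S1) (β : S1) (γ : S1) = _
    simp only [OrS1, sbtw_iff_btw_not_btw, btw_coe_iff_of_mem hα hβ hγ,
      btw_coe_iff_of_mem hγ hβ hα, keySign]
    obtain ⟨hα0, hα1⟩ := hα
    obtain ⟨hβ0, hβ1⟩ := hβ
    obtain ⟨hγ0, hγ1⟩ := hγ
    rcases lt_trichotomy α β with h1 | h1 | h1 <;> rcases lt_trichotomy β γ with h2 | h2 | h2 <;>
      rcases lt_trichotomy α γ with h3 | h3 | h3 <;> grind

/-! ### Bounds for degenerate configurations -/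

/-- The orientations of the triples of a configuration. -/
def orient (u : Fin 7 → S1) (i j k : Fin 7) : ℝ := OrS1 (u i) (u j) (u k)

theorem abs_altSum_tiedSign_lt (v w : Fin 7 → S1) :
    |altSum (fun i j k => ((cyc tiedSign i j k : ℤ) : ℝ)) (orient v) (orient w)| < 1232 := by
  obtain ⟨r, hr0, hr1, hrv, hr⟩ := exists_key (v 0)
  obtain ⟨s, hs0, hs1, hsw, hs⟩ := exists_key (w 0)
  have hv : orient v = cyc fun i j => keySign (r (v i)) (r (v j)) := by
    funext i j k
    exact hr _ _ _
  have hw : orient w = cyc fun i j => keySign (s (w i)) (s (w j)) := by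
    funext i j k
    exact hs _ _ _
  rw [hv, hw, altSum_tiedSign _ _ (fun _ _ => keySign_antisymm _ _)
    (fun _ => by rw [hrv, keySign_zero_left]) (fun _ _ => keySign_antisymm _ _)
    (fun _ => by rw [hsw, keySign_zero_left]), abs_mul, abs_of_pos (by norm_num)]
  have := abs_pairForm_keySign_le (fun i => r (v i.succ)) (fun i => s (w i.succ))
    (fun _ => hr0 _) (fun _ => hr1 _) (fun _ => hs0 _) (fun _ => hs1 _)
  linarith

/-- The permutation of `Fin 7` that fixes `0` and `1` and acts as `τ` on the other indices. -/
def fixTwo (τ : Equiv.Perm (Fin 5)) : Equiv.Perm (Fin 7) := consPerm 0 (consPerm 0 τ)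

theorem fixTwo_zero (τ : Equiv.Perm (Fin 5)) : fixTwo τ 0 = 0 := consPerm_zero _ _

theorem fixTwo_one (τ : Equiv.Perm (Fin 5)) : fixTwo τ 1 = 1 := by
  rw [fixTwo, ← Fin.succ_zero_eq_one, consPerm_succ, consPerm_zero]
  rfl

theorem fixTwo_succ_succ (τ : Equiv.Perm (Fin 5)) (i : Fin 5) :
    fixTwo τ i.succ.succ = (τ i).succ.succ := by
  simp [fixTwo, consPerm_succ]

theorem abs_altSum_fixTwo_lt (τ : Equiv.Perm (Fin 5)) (v w : Fin 7 → S1) :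
    |altSum (fun i j k => ((cyc tiedSign (fixTwo τ i) (fixTwo τ j) (fixTwo τ k) : ℤ) : ℝ))
      (orient v) (orient w)| < 1232 := by
  have h := abs_altSum_comp_perm (fixTwo τ) (fun i j k => ((cyc tiedSign i j k : ℤ) : ℝ))
    (orient (v ∘ (fixTwo τ).symm)) (orient (w ∘ (fixTwo τ).symm))
  simp only [orient, Function.comp_apply, Equiv.symm_apply_apply] at h
  exact h.trans_lt (abs_altSum_tiedSign_lt _ _)

theorem tiedSign_succ_succ (i j : Fin 5) :
    tiedSign i.succ.succ j.succ.succ = if i < j then 1 else if j < i then -1 else 0 := by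
  revert i j
  decide

theorem tiedSign_left {x : Fin 7} (hx : x ≤ 1) (y : Fin 7) : tiedSign x y = 0 := by
  simp [tiedSign, hx]

theorem tiedSign_right (x : Fin 7) {y : Fin 7} (hy : y ≤ 1) : tiedSign x y = 0 := by
  simp [tiedSign, hy]

theorem exists_keySign_eq_average_tiedSign (r : Fin 7 → ℝ) (h0 : ∀ i, 0 ≤ r i)
    (h1 : ∀ i, r i < 1) (hr0 : r 0 = 0) (hr1 : r 1 = 0) :
    ∃ σ τ : Equiv.Perm (Fin 5), ∀ x y, keySign (r x) (r y) =
      ((tiedSign (fixTwo σ x) (fixTwo σ y) : ℝ) + (tiedSign (fixTwo τ x) (fixTwo τ y) : ℝ)) / 2 := by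
  obtain ⟨σ, τ, h⟩ := exists_keySign_eq_average (fun i : Fin 5 => r i.succ.succ)
    (fun _ => h0 _) (fun _ => h1 _)
  refine ⟨σ, τ, fun x y => ?_⟩
  have hx : x = 0 ∨ x = 1 ∨ ∃ i : Fin 5, x = i.succ.succ := by
    revert x
    decide
  have hy : y = 0 ∨ y = 1 ∨ ∃ i : Fin 5, y = i.succ.succ := by
    revert y
    decide
  have h01 : (0 : Fin 7) ≤ 1 := by decide
  rcases hx with rfl | rfl | ⟨i, rfl⟩
  · simp [hr0, keySign_zero_left, fixTwo_zero, tiedSign_left h01]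
  · simp [hr1, keySign_zero_left, fixTwo_one, tiedSign_left le_rfl]
  · rcases hy with rfl | rfl | ⟨j, rfl⟩
    · simp [hr0, keySign_zero_right, fixTwo_zero, tiedSign_right _ h01]
    · simp [hr1, keySign_zero_right, fixTwo_one, tiedSign_right _ le_rfl]
    · rw [h i j]
      simp only [fixTwo_succ_succ, tiedSign_succ_succ, posSign]

theorem abs_altSum_lt_of_eq_zero_one (u v w : Fin 7 → S1) (hu : u 0 = u 1) :
    |altSum (orient u) (orient v) (orient w)| < 1232 := by
  obtain ⟨r, hr0, hr1, hru, hr⟩ := exists_key (u 0)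
  obtain ⟨σ, τ, h⟩ := exists_keySign_eq_average_tiedSign (fun i => r (u i)) (fun _ => hr0 _)
    (fun _ => hr1 _) hru (by rw [← hu, hru])
  have ha : orient u = fun i j k => (1 / 2 : ℝ) *
      (((cyc tiedSign (fixTwo σ i) (fixTwo σ j) (fixTwo σ k) : ℤ) : ℝ) +
        ((cyc tiedSign (fixTwo τ i) (fixTwo τ j) (fixTwo τ k) : ℤ) : ℝ)) := by
    funext i j k
    simp only [orient, hr, h, cyc, Int.cast_add]
    ring
  rw [ha, altSum_mul_left (1 / 2) fun i j k =>
    ((cyc tiedSign (fixTwo σ i) (fixTwo σ j) (fixTwo σ k) : ℤ) : ℝ) +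
      ((cyc tiedSign (fixTwo τ i) (fixTwo τ j) (fixTwo τ k) : ℤ) : ℝ), altSum_add_left]
  have h1 := abs_lt.1 (abs_altSum_fixTwo_lt σ v w)
  have h2 := abs_lt.1 (abs_altSum_fixTwo_lt τ v w)
  rw [abs_lt]
  constructor <;> linarith

theorem abs_altSum_lt_of_not_injective (u v w : Fin 7 → S1) (hu : ¬ Function.Injective u) :
    |altSum (orient u) (orient v) (orient w)| < 1232 := by
  obtain ⟨x, y, hxy, hne⟩ : ∃ x y, u x = u y ∧ x ≠ y := by
    simpa [Function.Injective] using hu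
  obtain ⟨π, h0, h1⟩ : ∃ π : Equiv.Perm (Fin 7), π 0 = x ∧ π 1 = y := by
    refine ⟨Equiv.swap (Equiv.swap 0 x 1) y * Equiv.swap 0 x, ?_, ?_⟩
    · rw [Equiv.Perm.mul_apply, Equiv.swap_apply_left, Equiv.swap_apply_of_ne_of_ne _ hne]
      intro h
      have := (Equiv.swap 0 x).injective ((Equiv.swap_apply_left 0 x).trans h)
      exact absurd this (by decide)
    · rw [Equiv.Perm.mul_apply, Equiv.swap_apply_left]
  have h := abs_altSum_comp_perm π (orient u) (orient v) (orient w)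
  rw [← h]
  exact abs_altSum_lt_of_eq_zero_one (u ∘ π) (v ∘ π) (w ∘ π) (by simp [h0, h1, hxy])

/-- If the first coordinates `θ₀¹,…,θ₆¹` take at least 4 distinct values but are not
pairwise distinct, then `|Θ(θ₀,…,θ₆)| < 11/45`. -/
theorem abs_Theta_lt_of_ge_four_distinct (θ : Fin 7 → T3)
    (h4 : 4 ≤ (Set.range fun j => (θ j).1).ncard)
    (hni : ¬ Function.Injective fun j => (θ j).1) :
    |Theta θ| < 11 / 45 := by
  have h := abs_altSum_lt_of_not_injective (fun j => (θ j).1) (fun j => (θ j).2.1)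
    (fun j => (θ j).2.2) hni
  have hT : Theta θ = (1 / (Nat.factorial 7 : ℝ)) * altSum (orient fun j => (θ j).1)
      (orient fun j => (θ j).2.1) (orient fun j => (θ j).2.2) := rfl
  have hf : (Nat.factorial 7 : ℝ) = 5040 := by norm_num [Nat.factorial]
  rw [hT, hf, abs_mul, abs_of_pos (by norm_num)]
  linarith
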